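/- Let c ∈ 𝕋 with c ≠ 0 and let t ≥ 0. Then P̄_top(tψ^c) = P̲_top(tψ^c) (the topological pressure exists as a limit and is finite) and lim_{m→∞} P̄_top(tψ^c | X^c_m) = P_top(tψ^c). -/

import Mathlib

open MeasureTheory Filter Topology Set
open scoped ENNReal

noncomputable section

namespace GTM

abbrev Torus := AddCircle (1 : ℝ)

instance : Fact ((0:ℝ) < 1) := ⟨one_pos⟩

/-- The doubling map on the torus. -/
def dbl (x : Torus) : Torus := x + x

/-- The function `x ↦ |cos (π x)|` lifted to the torus. -/
def absCos : Torus → ℝ :=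
  Function.Periodic.lift (f := fun x : ℝ => |Real.cos (Real.pi * x)|)
    (by
      intro x
      simp [mul_add, mul_one, Real.cos_add_pi, abs_neg])

/-- The potential `ψ^c(x) = 2 log |cos (π (x - c))|`, with value `⊥ = -∞` at the
singularity `c + 1/2`. -/
def psi (c : Torus) (x : Torus) : EReal :=
  if absCos (x - c) = 0 then ⊥ else ((2 * Real.log (absCos (x - c)) : ℝ) : EReal)

/-- The Birkhoff sums `ψ^c_n` of the potential `ψ^c` under the doubling map. -/
def psiSum (c : Torus) (n : ℕ) (x : Torus) : EReal :=
  ∑ k ∈ Finset.range n, psi c (dbl^[k] x)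

/-- The left endpoint of the dyadic cylinder interval of a binary word. -/
def wordVal (n : ℕ) (ω : Fin n → Bool) : ℝ :=
  ∑ i : Fin n, (if ω i then (1 : ℝ) else 0) / 2 ^ ((i : ℕ) + 1)

/-- The closed dyadic interval `⟨ω⟩ ⊆ 𝕋` associated to a binary word `ω`. -/
def cyl (n : ℕ) (ω : Fin n → Bool) : Set Torus :=
  (fun x : ℝ => (x : Torus)) '' Set.Icc (wordVal n ω) (wordVal n ω + 1 / 2 ^ n)

/-- The exponential function on extended reals, `exp ⊥ = 0`, `exp ⊤ = ∞`. -/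
def eexp (x : EReal) : ℝ≥0∞ :=
  if x = ⊥ then 0 else if x = ⊤ then ⊤ else ENNReal.ofReal (Real.exp x.toReal)

/-- The logarithm on `ℝ≥0∞`, `log 0 = ⊥`, `log ∞ = ⊤`. -/
def elog (x : ℝ≥0∞) : EReal :=
  if x = 0 then ⊥ else if x = ⊤ then ⊤ else ((Real.log x.toReal : ℝ) : EReal)

/-- The partition function `Σ_{ω ∈ {0,1}ⁿ} exp (t · sup_{x ∈ ⟨ω⟩} ψ^c_n(x))`. -/
def presZ (c : Torus) (t : ℝ) (n : ℕ) : ℝ≥0∞ :=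
  ∑ ω : Fin n → Bool, eexp ((t : EReal) * ⨆ x ∈ cyl n ω, psiSum c n x)

/-- The upper topological pressure `P̄_top(t ψ^c)`. -/
def presUpper (c : Torus) (t : ℝ) : EReal :=
  atTop.limsup fun n : ℕ => (((n : ℝ)⁻¹ : ℝ) : EReal) * elog (presZ c t n)

/-- The lower topological pressure `P̲_top(t ψ^c)`. -/
def presLower (c : Torus) (t : ℝ) : EReal :=
  atTop.liminf fun n : ℕ => (((n : ℝ)⁻¹ : ℝ) : EReal) * elog (presZ c t n)

/-- The point of the torus with binary digit sequence `x` (digits `x 0 = x₁, x 1 = x₂, …`). -/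
def toTorus (x : ℕ → Bool) : Torus :=
  ((∑' i : ℕ, (if x i then (1 : ℝ) else 0) / 2 ^ (i + 1) : ℝ) : Torus)

/-- `b` is a binary expansion of the point `y ∈ 𝕋`. -/
def IsBinExp (y : Torus) (b : ℕ → Bool) : Prop := toTorus b = y

/-- The singularity position `c̆ = c + 1/2`. -/
def breve (c : Torus) : Torus := c + (((1 : ℝ) / 2 : ℝ) : Torus)

/-- The subshift `X^c_m` of all binary sequences avoiding the words consisting of the
first `m+1` digits of (any) binary expansion of `c̆`. -/
def Xcm (c : Torus) (m : ℕ) : Set (ℕ → Bool) :=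
  {x | ∀ ℓ : ℕ, ∀ b : ℕ → Bool, IsBinExp (breve c) b → ∃ i : Fin (m + 1), x (ℓ + i) ≠ b i}

open Classical in
/-- The partition function of the pressure restricted to `X^c_m`: the sum runs over the
words `ω ∈ Σ'ⁿ_m` whose cylinder meets `X^c_m`, with `sup` of `ψ^c_n` over the points of
`X^c_m` starting with `ω`. -/
def presZRes (c : Torus) (m : ℕ) (t : ℝ) (n : ℕ) : ℝ≥0∞ :=
  ∑ ω : Fin n → Bool,
    if ∃ x ∈ Xcm c m, ∀ i : Fin n, x i = ω i then
      eexp ((t : EReal) *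
        ⨆ x ∈ {x ∈ Xcm c m | ∀ i : Fin n, x i = ω i}, psiSum c n (toTorus x))
    else 0

/-- The restricted upper topological pressure `P̄_top(t ψ^c | X^c_m)`. -/
def presResUpper (c : Torus) (m : ℕ) (t : ℝ) : EReal :=
  atTop.limsup fun n : ℕ => (((n : ℝ)⁻¹ : ℝ) : EReal) * elog (presZRes c m t n)

/-! ### Binary expansions and the doubling map -/

/-- The real number in `[0, 1]` with binary digits `x`. -/
def binVal (x : ℕ → Bool) : ℝ := ∑' i : ℕ, (if x i then (1 : ℝ) else 0) / 2 ^ (i + 1)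

/-- The left shift by `n` places. -/
def shift (n : ℕ) (x : ℕ → Bool) : ℕ → Bool := fun i => x (i + n)

/-- The sequence obtained by writing the word `ω` in front of `y`. -/
def wordAppend (n : ℕ) (ω : Fin n → Bool) (y : ℕ → Bool) : ℕ → Bool :=
  fun i => if h : i < n then ω ⟨i, h⟩ else y (i - n)

/-- The sequence obtained by writing the letter `b` in front of `y`. -/
def letterCons (b : Bool) (y : ℕ → Bool) : ℕ → Bool
  | 0 => b
  | i + 1 => y i

lemma shift_shift (m n : ℕ) (x : ℕ → Bool) : shift m (shift n x) = shift (m + n) x := by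
  funext i
  simp [shift, add_assoc]

lemma shift_one_letterCons (b : Bool) (y : ℕ → Bool) : shift 1 (letterCons b y) = y := rfl

lemma shift_wordAppend (n : ℕ) (ω : Fin n → Bool) (y : ℕ → Bool) :
    shift n (wordAppend n ω y) = y := by
  funext i
  simp [shift, wordAppend]

lemma wordAppend_apply (n : ℕ) (ω : Fin n → Bool) (y : ℕ → Bool) (i : Fin n) :
    wordAppend n ω y i = ω i := by
  simp [wordAppend]

lemma toTorus_eq (x : ℕ → Bool) : toTorus x = (binVal x : Torus) := rfl

lemma hasSum_half_pow : HasSum (fun i : ℕ => (1 : ℝ) / 2 ^ (i + 1)) 1 := by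
  have h := hasSum_geometric_two.mul_left (1 / 2 : ℝ)
  have e : (fun i : ℕ => (1 : ℝ) / 2 ^ (i + 1)) = fun i : ℕ => 1 / 2 * (1 / 2) ^ i := by
    funext i
    rw [pow_succ', div_pow, one_pow, div_mul_div_comm, one_mul]
  rw [e]
  rwa [show (1 / 2 : ℝ) * 2 = 1 by norm_num] at h

lemma binTerm_nonneg (x : ℕ → Bool) (i : ℕ) :
    0 ≤ (if x i then (1 : ℝ) else 0) / 2 ^ (i + 1) := by
  split_ifs <;> positivity

lemma binTerm_le (x : ℕ → Bool) (i : ℕ) :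
    (if x i then (1 : ℝ) else 0) / 2 ^ (i + 1) ≤ 1 / 2 ^ (i + 1) := by
  gcongr
  split_ifs <;> norm_num

lemma summable_binVal (x : ℕ → Bool) :
    Summable fun i : ℕ => (if x i then (1 : ℝ) else 0) / 2 ^ (i + 1) :=
  Summable.of_nonneg_of_le (binTerm_nonneg x) (binTerm_le x) hasSum_half_pow.summable

lemma binVal_nonneg (x : ℕ → Bool) : 0 ≤ binVal x := tsum_nonneg (binTerm_nonneg x)

lemma binVal_le_one (x : ℕ → Bool) : binVal x ≤ 1 := by
  rw [← hasSum_half_pow.tsum_eq]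
  exact (summable_binVal x).tsum_le_tsum (binTerm_le x) hasSum_half_pow.summable

lemma binVal_eq_wordVal_add (n : ℕ) (x : ℕ → Bool) :
    binVal x = wordVal n (fun i => x i) + binVal (shift n x) / 2 ^ n := by
  unfold binVal wordVal
  rw [← (summable_binVal x).sum_add_tsum_nat_add n, ← tsum_div_const, Finset.sum_range]
  congr 1
  refine tsum_congr fun i => ?_
  rw [div_div, ← pow_add, shift]
  congr 2
  ring

lemma exists_int_eq_two_pow_mul_wordVal (n : ℕ) (ω : Fin n → Bool) :
    ∃ k : ℤ, 2 ^ n * wordVal n ω = k := by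
  refine ⟨∑ i : Fin n, if ω i then 2 ^ (n - (i + 1)) else 0, ?_⟩
  rw [wordVal, Finset.mul_sum]
  push_cast
  refine Finset.sum_congr rfl fun i _ => ?_
  split_ifs
  · rw [mul_one_div, pow_sub₀ _ two_ne_zero (by omega : (i : ℕ) + 1 ≤ n), div_eq_mul_inv]
  · simp

lemma dbl_iterate_coe (n : ℕ) (ξ : ℝ) : dbl^[n] (ξ : Torus) = ((2 ^ n * ξ : ℝ) : Torus) := by
  induction n with
  | zero => simp
  | succ n ih =>
    rw [Function.iterate_succ_apply', ih, dbl, ← AddCircle.coe_add]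
    congr 1
    ring

lemma coe_int_eq_zero (k : ℤ) : ((k : ℝ) : Torus) = 0 := by
  rw [AddCircle.coe_eq_zero_iff]
  exact ⟨k, by simp⟩

lemma dbl_iterate_toTorus (n : ℕ) (x : ℕ → Bool) :
    dbl^[n] (toTorus x) = toTorus (shift n x) := by
  obtain ⟨k, hk⟩ := exists_int_eq_two_pow_mul_wordVal n fun i => x i
  rw [toTorus_eq, toTorus_eq, dbl_iterate_coe, binVal_eq_wordVal_add n x, mul_add, hk,
    AddCircle.coe_add, coe_int_eq_zero, zero_add]
  congr 1
  field_simp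

lemma norm_dbl_sub_le (a b : Torus) : ‖dbl a - dbl b‖ ≤ 2 * ‖a - b‖ := by
  have : dbl a - dbl b = (a - b) + (a - b) := by unfold dbl; abel
  rw [this, two_mul]
  exact norm_add_le _ _

lemma norm_dbl_iterate_sub_le (n : ℕ) (a b : Torus) :
    ‖dbl^[n] a - dbl^[n] b‖ ≤ 2 ^ n * ‖a - b‖ := by
  induction n with
  | zero => simp
  | succ n ih =>
    rw [Function.iterate_succ_apply', Function.iterate_succ_apply', pow_succ']
    nlinarith [norm_dbl_sub_le (dbl^[n] a) (dbl^[n] b)]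

lemma norm_coe_le_abs (ξ : ℝ) : ‖(ξ : Torus)‖ ≤ |ξ| := by
  rw [UnitAddCircle.norm_eq]
  simpa using round_le ξ 0

lemma exists_coe_eq_abs_eq_norm (x : Torus) : ∃ v : ℝ, (v : Torus) = x ∧ |v| = ‖x‖ := by
  induction x using QuotientAddGroup.induction_on with
  | H ξ =>
    refine ⟨ξ - round ξ, ?_, (UnitAddCircle.norm_eq).symm⟩
    rw [AddCircle.coe_sub, coe_int_eq_zero, sub_zero]

lemma norm_coe_half : ‖((1 / 2 : ℝ) : Torus)‖ = 1 / 2 := by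
  simpa using AddCircle.norm_half_period_eq (1 : ℝ)

lemma norm_le_half (x : Torus) : ‖x‖ ≤ 1 / 2 := by
  simpa using AddCircle.norm_le_half_period (1 : ℝ) (x := x) one_ne_zero

lemma coe_half_add_half : ((1 / 2 : ℝ) : Torus) + ((1 / 2 : ℝ) : Torus) = 0 := by
  rw [← AddCircle.coe_add, add_halves]
  exact_mod_cast coe_int_eq_zero 1

lemma toTorus_mem_cyl {n : ℕ} {ω : Fin n → Bool} {x : ℕ → Bool} (h : ∀ i : Fin n, x i = ω i) :
    toTorus x ∈ cyl n ω := by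
  refine ⟨binVal x, ?_, rfl⟩
  rw [binVal_eq_wordVal_add n x, funext h]
  have h0 := binVal_nonneg (shift n x)
  have h1 := binVal_le_one (shift n x)
  constructor
  · have : 0 ≤ binVal (shift n x) / 2 ^ n := by positivity
    linarith
  · gcongr

lemma norm_sub_le_of_mem_cyl {n : ℕ} {ω : Fin n → Bool} {x z : Torus} (hx : x ∈ cyl n ω)
    (hz : z ∈ cyl n ω) : ‖x - z‖ ≤ 1 / 2 ^ n := by
  obtain ⟨ξ, hξ, rfl⟩ := hx
  obtain ⟨ζ, hζ, rfl⟩ := hz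
  simp only [← AddCircle.coe_sub]
  refine (norm_coe_le_abs _).trans ?_
  rw [abs_le]
  constructor <;> linarith [hξ.1, hξ.2, hζ.1, hζ.2]

lemma wordVal_append {n m : ℕ} (a : Fin n → Bool) (b : Fin m → Bool) :
    wordVal (n + m) (Fin.append a b) = wordVal n a + wordVal m b / 2 ^ n := by
  unfold wordVal
  rw [Fin.sum_univ_add, Finset.sum_div]
  congr 1
  · simp
  · refine Finset.sum_congr rfl fun i _ => ?_
    rw [Fin.append_right, div_div, ← pow_add]
    congr 2
    simp
    ring

lemma wordVal_nonneg (n : ℕ) (ω : Fin n → Bool) : 0 ≤ wordVal n ω :=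
  Finset.sum_nonneg fun i _ => by split_ifs <;> positivity

lemma wordVal_add_le_one (n : ℕ) (ω : Fin n → Bool) : wordVal n ω + 1 / 2 ^ n ≤ 1 := by
  have h1 := binVal_le_one (wordAppend n ω fun _ => true)
  rw [binVal_eq_wordVal_add n, shift_wordAppend] at h1
  have h2 : binVal (fun _ => true) = 1 := by simpa [binVal] using hasSum_half_pow.tsum_eq
  simpa [h2, wordAppend_apply] using h1

lemma mem_cyl_of_mem_cyl_append {n m : ℕ} {a : Fin n → Bool} {b : Fin m → Bool} {x : Torus}
    (hx : x ∈ cyl (n + m) (Fin.append a b)) : x ∈ cyl n a ∧ dbl^[n] x ∈ cyl m b := by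
  obtain ⟨ξ, ⟨h1, h2⟩, rfl⟩ := hx
  rw [wordVal_append] at h1 h2
  have hp : (0 : ℝ) < 2 ^ n := by positivity
  have hb0 := wordVal_nonneg m b
  have hb1 := wordVal_add_le_one m b
  have e : wordVal n a + wordVal m b / 2 ^ n + 1 / 2 ^ (n + m)
      = wordVal n a + (wordVal m b + 1 / 2 ^ m) / 2 ^ n := by
    rw [pow_add]; field_simp; ring
  rw [e] at h2
  constructor
  · refine ⟨ξ, ⟨?_, ?_⟩, rfl⟩
    · have : 0 ≤ wordVal m b / 2 ^ n := by positivity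
      linarith
    · refine h2.trans ?_
      gcongr
  · obtain ⟨k, hk⟩ := exists_int_eq_two_pow_mul_wordVal n a
    refine ⟨2 ^ n * ξ - k, ⟨?_, ?_⟩, ?_⟩
    · have := mul_le_mul_of_nonneg_left h1 hp.le
      rw [mul_add, hk, mul_div_cancel₀ _ hp.ne'] at this
      linarith
    · have := mul_le_mul_of_nonneg_left h2 hp.le
      rw [mul_add, hk, mul_div_cancel₀ _ hp.ne'] at this
      linarith
    · simp only [dbl_iterate_coe]
      rw [AddCircle.coe_sub, coe_int_eq_zero, sub_zero]

/-! ### The potential -/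

lemma absCos_coe (u : ℝ) : absCos (u : Torus) = |Real.cos (Real.pi * u)| := rfl

lemma absCos_nonneg (x : Torus) : 0 ≤ absCos x := by
  induction x using QuotientAddGroup.induction_on with
  | H u => exact abs_nonneg _

lemma absCos_le_one (x : Torus) : absCos x ≤ 1 := by
  induction x using QuotientAddGroup.induction_on with
  | H u => exact Real.abs_cos_le_one _

lemma absCos_le_add (a b : Torus) : absCos a ≤ absCos b + Real.pi * ‖a - b‖ := by
  obtain ⟨w, hw, hn⟩ := exists_coe_eq_abs_eq_norm (a - b)
  obtain rfl : a = b + w := by rw [hw]; abel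
  rw [← hn]
  induction b using QuotientAddGroup.induction_on with
  | H u =>
    change absCos ((u : Torus) + w) ≤ absCos (u : Torus) + _
    rw [← AddCircle.coe_add, absCos_coe, absCos_coe]
    have h1 : |Real.cos (Real.pi * (u + w)) - Real.cos (Real.pi * u)| ≤ Real.pi * |w| := by
      have := Real.abs_cos_sub_cos_le (Real.pi * (u + w)) (Real.pi * u)
      rw [← mul_sub, add_sub_cancel_left, abs_mul, abs_of_pos Real.pi_pos] at this
      exact this
    linarith [abs_sub_abs_le_abs_sub (Real.cos (Real.pi * (u + w))) (Real.cos (Real.pi * u))]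

lemma two_mul_norm_le_absCos (c x : Torus) : 2 * ‖x - breve c‖ ≤ absCos (x - c) := by
  obtain ⟨v, hv, hn⟩ := exists_coe_eq_abs_eq_norm (x - breve c)
  have hvh : |v| ≤ 1 / 2 := hn ▸ norm_le_half _
  have : x - c = ((v + 1 / 2 : ℝ) : Torus) := by
    rw [AddCircle.coe_add, hv, breve]; abel
  rw [this, absCos_coe, ← hn]
  have e : Real.pi * (v + 1 / 2) = Real.pi * v + Real.pi / 2 := by ring
  rw [e, Real.cos_add_pi_div_two, abs_neg]
  have h1 : |Real.sin (Real.pi * v)| = |Real.sin (Real.pi * |v|)| := by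
    rcases abs_cases v with ⟨h, _⟩ | ⟨h, _⟩ <;> rw [h]
    rw [mul_neg, Real.sin_neg, abs_neg]
  rw [h1]
  have h2 : 2 / Real.pi * (Real.pi * |v|) ≤ Real.sin (Real.pi * |v|) := by
    apply Real.mul_le_sin
    · positivity
    · nlinarith [Real.pi_pos]
  have h3 : 2 / Real.pi * (Real.pi * |v|) = 2 * |v| := by
    field_simp
  rw [h3] at h2
  exact h2.trans (le_abs_self _)

/-! ### Preimage branches that stay away from the singularity -/

lemma binVal_letterCons (b : Bool) (y : ℕ → Bool) :
    binVal (letterCons b y) = (if b then 1 else 0) / 2 + binVal y / 2 := by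
  rw [binVal_eq_wordVal_add 1, shift_one_letterCons, wordVal]
  simp [letterCons]

lemma toTorus_letterCons_not (b : Bool) (y : ℕ → Bool) :
    toTorus (letterCons (!b) y) = toTorus (letterCons b y) + ((1 / 2 : ℝ) : Torus) := by
  rw [toTorus_eq, toTorus_eq, binVal_letterCons, binVal_letterCons]
  cases b
  · rw [← AddCircle.coe_add]
    congr 1
    simp
    ring
  · rw [AddCircle.coe_add, AddCircle.coe_add, add_right_comm]
    simp only [Bool.not_true, Bool.false_eq_true, if_false, if_true, coe_half_add_half]
    simp

lemma letterCons_shift_one (x : ℕ → Bool) : letterCons (x 0) (shift 1 x) = x := by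
  funext i
  cases i <;> rfl

lemma dbl_toTorus_letterCons (b : Bool) (y : ℕ → Bool) :
    dbl (toTorus (letterCons b y)) = toTorus y := by
  simpa [shift_one_letterCons] using dbl_iterate_toTorus 1 (letterCons b y)

lemma eq_of_shift_eq_of_norm_sub_lt (s : ℕ) (w w' : ℕ → Bool) (h : shift s w = shift s w')
    (hn : ‖toTorus w - toTorus w'‖ < 1 / 2 ^ s) : w = w' := by
  induction s generalizing w w' with
  | zero => exact h
  | succ s ih =>
    have h1 : shift 1 w = shift 1 w' := by
      refine ih _ _ (by rwa [shift_shift, shift_shift]) ?_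
      rw [← dbl_iterate_toTorus, ← dbl_iterate_toTorus]
      have := norm_dbl_iterate_sub_le 1 (toTorus w) (toTorus w')
      have e : (1 : ℝ) / 2 ^ s = 2 ^ 1 * (1 / 2 ^ (s + 1)) := by rw [pow_one, pow_succ']; field_simp
      rw [e]
      nlinarith
    by_cases h0 : w 0 = w' 0
    · rw [← letterCons_shift_one w, ← letterCons_shift_one w', h0, h1]
    · exfalso
      have h0' : w 0 = !w' 0 := by
        cases hw : w 0 <;> cases hw' : w' 0 <;> simp_all
      rw [← letterCons_shift_one w, ← letterCons_shift_one w', h0', h1, toTorus_letterCons_not,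
        add_sub_cancel_left, norm_coe_half, pow_succ] at hn
      have : (1 : ℝ) / (2 ^ s * 2) ≤ 1 / 2 := by
        gcongr
        have := one_le_pow₀ (M₀ := ℝ) (a := 2) one_le_two (n := s)
        linarith
      linarith

lemma half_le_norm_add_norm (q : Torus) (b : Bool) (y : ℕ → Bool) :
    1 / 2 ≤ ‖toTorus (letterCons b y) - q‖ + ‖toTorus (letterCons (!b) y) - q‖ := by
  have h : ((1 / 2 : ℝ) : Torus) =
      (toTorus (letterCons (!b) y) - q) - (toTorus (letterCons b y) - q) := by
    rw [toTorus_letterCons_not]; abel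
  have := norm_sub_le (toTorus (letterCons (!b) y) - q) (toTorus (letterCons b y) - q)
  rw [← h, norm_coe_half] at this
  linarith

lemma exists_letterCons_far (q : Torus) (y : ℕ → Bool) :
    ∃ b, 1 / 4 ≤ ‖toTorus (letterCons b y) - q‖ := by
  by_contra! h
  linarith [half_le_norm_add_norm q true y, h true, h (!true)]

/-- Every point has two second-order preimages whose orbits avoid the ball of radius `‖c‖ / 3`
around the singularity. -/
lemma exists_two_preimages (c : Torus) (y : ℕ → Bool) :
    ∃ w : Bool → ℕ → Bool, w true ≠ w false ∧ ∀ b, shift 2 (w b) = y ∧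
      ‖c‖ / 3 ≤ ‖toTorus (w b) - breve c‖ ∧ ‖c‖ / 3 ≤ ‖dbl (toTorus (w b)) - breve c‖ := by
  have hc := norm_le_half c
  by_cases h : ∀ b, ‖c‖ / 3 ≤ ‖toTorus (letterCons b y) - breve c‖
  · choose e he using fun b => exists_letterCons_far (breve c) (letterCons b y)
    refine ⟨fun b => letterCons (e b) (letterCons b y), fun H => ?_, fun b => ⟨rfl, ?_, ?_⟩⟩
    · simpa [letterCons] using congrFun H 1
    · linarith [he b]
    · rw [dbl_toTorus_letterCons]
      exact h b
  · push Not at h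
    obtain ⟨b, hb⟩ := h
    have hb' := half_le_norm_add_norm (breve c) b y
    refine ⟨fun e => letterCons e (letterCons (!b) y), fun H => ?_, fun e => ⟨rfl, ?_, ?_⟩⟩
    · simpa [letterCons] using congrFun H 0
    · by_contra! hlt
      have h1 := norm_dbl_sub_le (toTorus (letterCons e (letterCons (!b) y))) (breve c)
      rw [dbl_toTorus_letterCons, toTorus_letterCons_not] at h1
      have h2 : c = (toTorus (letterCons b y) - breve c) -
          (toTorus (letterCons b y) + ((1 / 2 : ℝ) : Torus) - dbl (breve c)) := by
        unfold dbl
        have e2 : breve c = c + ((1 / 2 : ℝ) : Torus) := rfl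
        have : c + (((1 / 2 : ℝ) : Torus) + ((1 / 2 : ℝ) : Torus)) = c := by
          rw [coe_half_add_half, add_zero]
        rw [e2]
        abel
      have h3 := norm_sub_le (toTorus (letterCons b y) - breve c)
        (toTorus (letterCons b y) + ((1 / 2 : ℝ) : Torus) - dbl (breve c))
      rw [← h2] at h3
      linarith
    · rw [dbl_toTorus_letterCons]
      linarith

lemma exists_many_preimages (c : Torus) (p : ℕ) (y : ℕ → Bool) :
    ∃ F : Finset (ℕ → Bool), F.card = 2 ^ p ∧ ∀ w ∈ F, shift (2 * p) w = y ∧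
      ∀ i < 2 * p, ‖c‖ / 3 ≤ ‖dbl^[i] (toTorus w) - breve c‖ := by
  classical
  induction p generalizing y with
  | zero => exact ⟨{y}, by simp, by simp; rfl⟩
  | succ p ih =>
    obtain ⟨w, hne, hw⟩ := exists_two_preimages c y
    choose F hcard hF using fun b => ih (w b)
    have hdisj : Disjoint (F true) (F false) := by
      rw [Finset.disjoint_left]
      intro x h1 h2
      exact hne ((hF _ x h1).1.symm.trans (hF _ x h2).1)
    refine ⟨F true ∪ F false, by rw [Finset.card_union_of_disjoint hdisj, hcard, hcard]; ring, ?_⟩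
    have key : ∀ b, ∀ x ∈ F b, shift (2 * (p + 1)) x = y ∧
        ∀ i < 2 * (p + 1), ‖c‖ / 3 ≤ ‖dbl^[i] (toTorus x) - breve c‖ := by
      intro b x hx
      obtain ⟨h1, h2⟩ := hF b x hx
      obtain ⟨g1, g2, g3⟩ := hw b
      refine ⟨by rw [← g1, ← h1, shift_shift]; congr 1; ring, fun i hi => ?_⟩
      rcases lt_or_ge i (2 * p) with hlt | hge
      · exact h2 i hlt
      · rcases (by omega : i = 2 * p ∨ i = 2 * p + 1) with rfl | rfl
        · rwa [dbl_iterate_toTorus, h1]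
        · rwa [Function.iterate_succ_apply', dbl_iterate_toTorus, h1]
    intro x hx
    rcases Finset.mem_union.1 hx with h | h
    exacts [key _ x h, key _ x h]

/-- A preimage branch avoiding the singularity whose endpoint is also separated from the first
`n` iterates of the singularity. -/
lemma exists_spacer (c : Torus) (p n : ℕ) (hn : n < 2 ^ p) (y : ℕ → Bool) :
    ∃ w : ℕ → Bool, shift (2 * p) w = y ∧
      (∀ i < 2 * p, ‖c‖ / 3 ≤ ‖dbl^[i] (toTorus w) - breve c‖) ∧
      ∀ j ∈ Finset.Icc 1 n, 1 / 2 ^ (2 * p + 1) ≤ ‖toTorus w - dbl^[j] (breve c)‖ := by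
  obtain ⟨F, hcard, hF⟩ := exists_many_preimages c p y
  by_contra! H
  have H' : ∀ w ∈ F, ∃ j ∈ Finset.Icc 1 n, ‖toTorus w - dbl^[j] (breve c)‖ < 1 / 2 ^ (2 * p + 1) :=
    fun w hw => H w (hF w hw).1 (hF w hw).2
  choose! f hf hf' using H'
  obtain ⟨w, hw, w', hw', hne, he⟩ := Finset.exists_ne_map_eq_of_card_lt_of_maps_to
    (by rw [hcard]; simpa using hn) hf
  refine hne (eq_of_shift_eq_of_norm_sub_lt (2 * p) w w'
    ((hF w hw).1.trans (hF w' hw').1.symm) ?_)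
  have h1 := hf' w hw
  have h2 := hf' w' hw'
  rw [← he] at h2
  have h3 := norm_sub_le (toTorus w - dbl^[f w] (breve c)) (toTorus w' - dbl^[f w] (breve c))
  rw [sub_sub_sub_cancel_right] at h3
  have e : (1 : ℝ) / 2 ^ (2 * p) = 2 * (1 / 2 ^ (2 * p + 1)) := by rw [pow_succ]; field_simp
  rw [e]
  linarith

/-- There is a point whose orbit stays away from the singularity. -/
lemma exists_orbit_far (c : Torus) :
    ∃ y : ℕ → Bool, ∃ ρ : ℝ, 0 < ρ ∧ ∀ k, ρ ≤ ‖dbl^[k] (toTorus y) - breve c‖ := by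
  by_cases h : breve c = 0
  · let a : ℕ → Bool := fun i => decide (i % 2 = 0)
    let b : ℕ → Bool := fun i => decide (i % 2 = 1)
    have ha : a = letterCons true b := by
      funext i
      cases i with
      | zero => rfl
      | succ i => simp only [a, b, letterCons]; congr 1; apply propext; omega
    have hb : b = letterCons false a := by
      funext i
      cases i with
      | zero => rfl
      | succ i => simp only [a, b, letterCons]; congr 1; apply propext; omega
    have ea : binVal a = 1 / 2 + binVal b / 2 := by
      conv_lhs => rw [ha, binVal_letterCons]
      simp
    have eb : binVal b = binVal a / 2 := by
      conv_lhs => rw [hb, binVal_letterCons]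
      simp
    have vb : binVal b = 1 / 3 := by linarith
    have da : dbl (toTorus a) = toTorus b := by
      conv_lhs => rw [ha, dbl_toTorus_letterCons]
    have db : dbl (toTorus b) = toTorus a := by
      conv_lhs => rw [hb, dbl_toTorus_letterCons]
    have nb : ‖toTorus b‖ = 1 / 3 := by
      rw [toTorus_eq, vb, (AddCircle.norm_coe_eq_abs_iff (1 : ℝ) one_ne_zero).2] <;>
        rw [abs_of_pos (by norm_num)]
      norm_num
    have na : 1 / 6 ≤ ‖toTorus a‖ := by
      have := norm_dbl_sub_le (toTorus a) 0
      rw [da, show dbl 0 = 0 from add_zero 0, sub_zero, sub_zero, nb] at this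
      linarith
    have orbit : ∀ k, dbl^[k] (toTorus b) = toTorus a ∨ dbl^[k] (toTorus b) = toTorus b := by
      intro k
      induction k with
      | zero => exact Or.inr rfl
      | succ k ih =>
        rw [Function.iterate_succ_apply']
        rcases ih with ih | ih <;> rw [ih]
        exacts [Or.inr da, Or.inl db]
    refine ⟨b, 1 / 6, by norm_num, fun k => ?_⟩
    rw [h, sub_zero]
    rcases orbit k with h | h <;> rw [h]
    · exact na
    · rw [nb]; norm_num
  · refine ⟨fun _ => false, ‖breve c‖, norm_pos_iff.2 h, fun k => ?_⟩
    have : binVal (fun _ => false) = 0 := by simp [binVal]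
    rw [dbl_iterate_toTorus, toTorus_eq]
    change _ ≤ ‖((binVal fun _ => false : ℝ) : Torus) - breve c‖
    rw [this]
    simp

/-! ### Comparing Birkhoff sums along a cylinder -/

/-- The real-valued version of the potential, with a junk value at the singularity. -/
def realPsi (c x : Torus) : ℝ := 2 * Real.log (absCos (x - c))

lemma psiSum_eq_birkhoffSum {c : Torus} {n : ℕ} {x : Torus}
    (h : ∀ k < n, absCos (dbl^[k] x - c) ≠ 0) :
    psiSum c n x = (birkhoffSum dbl (realPsi c) n x : ℝ) := by
  induction n with
  | zero => simp [psiSum, birkhoffSum]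
  | succ n ih =>
    rw [birkhoffSum_succ, EReal.coe_add, ← ih fun k hk => h k (hk.trans n.lt_succ_self), psiSum,
      Finset.sum_range_succ, ← psiSum, psi, if_neg (h n n.lt_succ_self), realPsi]

lemma psiSum_eq_bot {c : Torus} {n k : ℕ} {x : Torus} (hk : k < n)
    (h : absCos (dbl^[k] x - c) = 0) : psiSum c n x = ⊥ := by
  unfold psiSum
  rw [← Finset.add_sum_erase _ _ (Finset.mem_range.2 hk), psi, if_pos h, EReal.bot_add]

lemma realPsi_nonpos (c x : Torus) : realPsi c x ≤ 0 :=
  mul_nonpos_of_nonneg_of_nonpos zero_le_two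
    (Real.log_nonpos (absCos_nonneg _) (absCos_le_one _))

lemma psiSum_nonpos (c : Torus) (n : ℕ) (x : Torus) : psiSum c n x ≤ 0 := by
  by_cases h : ∀ k < n, absCos (dbl^[k] x - c) ≠ 0
  · rw [psiSum_eq_birkhoffSum h]
    exact_mod_cast Finset.sum_nonpos fun k _ => realPsi_nonpos c _
  · push Not at h
    obtain ⟨k, hk, h⟩ := h
    rw [psiSum_eq_bot hk h]
    exact bot_le

lemma log_le_log_add {X Z : ℝ} {e q h : ℕ} (hq : 3 ≤ q) (hX : 0 < X) (hX1 : X ≤ 1)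
    (hXZ : X ≤ Z + 4 * (1 / 2 ^ e)) (hdZ : 1 / 2 ^ e ≤ Z * 2 ^ h) :
    Real.log X ≤ Real.log Z + (if e < 2 * q then ((h : ℝ) + 3) * Real.log 2 else 0)
      + -Real.log (1 - 4 / 2 ^ q) + ((h : ℝ) + 3) / q * -Real.log X := by
  have hl2 : 0 < Real.log 2 := Real.log_pos one_lt_two
  have hd : (0 : ℝ) < 1 / 2 ^ e := by positivity
  have hZ : 0 < Z := by
    by_contra! hZ
    have := mul_nonpos_of_nonpos_of_nonneg hZ (by positivity : (0 : ℝ) ≤ 2 ^ h)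
    linarith
  have h2q : (8 : ℝ) ≤ 2 ^ q := by
    calc (8 : ℝ) = 2 ^ 3 := by norm_num
      _ ≤ 2 ^ q := pow_le_pow_right₀ one_le_two hq
  have hfrac : (4 : ℝ) / 2 ^ q ≤ 1 / 2 := by
    rw [div_le_div_iff₀ (by positivity) two_pos]; linarith
  have hfrac0 : (0 : ℝ) < 4 / 2 ^ q := by positivity
  have hη : 0 ≤ -Real.log (1 - 4 / 2 ^ q) := by
    have := Real.log_nonpos (x := 1 - 4 / 2 ^ q) (by linarith) (by linarith)
    linarith
  have hX0 : 0 ≤ -Real.log X := by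
    have := Real.log_nonpos hX.le hX1
    linarith
  have hq0 : (0 : ℝ) < q := by exact_mod_cast (by omega : 0 < q)
  have hβ : 0 ≤ ((h : ℝ) + 3) / q * -Real.log X := by positivity
  have hB : 0 ≤ ((h : ℝ) + 3) * Real.log 2 := by positivity
  have hall : Real.log X ≤ Real.log Z + ((h : ℝ) + 3) * Real.log 2 := by
    have e1 : Real.log Z + ((h : ℝ) + 3) * Real.log 2 = Real.log (Z * 2 ^ (h + 3)) := by
      rw [Real.log_mul hZ.ne' (by positivity), Real.log_pow]
      push_cast
      ring
    rw [e1]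
    apply Real.log_le_log hX
    have h1 : (1 : ℝ) ≤ 2 ^ h := one_le_pow₀ one_le_two
    have h3 : Z * 2 ^ (h + 3) = 8 * (Z * 2 ^ h) := by rw [pow_add]; ring
    rw [h3]
    nlinarith
  by_cases he : e < 2 * q
  · rw [if_pos he]
    linarith
  rw [if_neg he]
  by_cases hθ : X ≤ 1 / 2 ^ q
  · have h1 : (q : ℝ) * Real.log 2 ≤ -Real.log X := by
      have := Real.log_le_log hX hθ
      rw [one_div, Real.log_inv, Real.log_pow] at this
      linarith
    have h2 : ((h : ℝ) + 3) * Real.log 2 ≤ ((h : ℝ) + 3) / q * -Real.log X := by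
      calc ((h : ℝ) + 3) * Real.log 2 = ((h : ℝ) + 3) / q * (q * Real.log 2) := by
            field_simp
        _ ≤ _ := by gcongr
    linarith
  · push Not at hθ
    have h1 : (1 : ℝ) / 2 ^ e ≤ 1 / 2 ^ q * (1 / 2 ^ q) := by
      rw [div_mul_div_comm, one_mul, ← pow_add]
      gcongr
      · exact one_le_two
      · omega
    have h2 : X * (1 - 4 / 2 ^ q) ≤ Z := by
      have h3 : 1 / 2 ^ q * (1 / 2 ^ q) ≤ X * (1 / 2 ^ q) := by gcongr
      have h4 : X * (1 - 4 / 2 ^ q) = X - 4 * (X * (1 / 2 ^ q)) := by ring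
      linarith
    have h5 := Real.log_le_log (mul_pos hX (by linarith)) h2
    rw [Real.log_mul hX.ne' (by linarith)] at h5
    linarith

lemma birkhoffSum_le_of_mem_cyl {c : Torus} {n h q : ℕ} {ω : Fin n → Bool} {x z : Torus}
    (hq : 3 ≤ q) (hx : x ∈ cyl n ω) (hz : z ∈ cyl n ω)
    (hx0 : ∀ k < n, absCos (dbl^[k] x - c) ≠ 0)
    (hz0 : ∀ k < n, 1 / 2 ^ (n - k) ≤ absCos (dbl^[k] z - c) * 2 ^ h) :
    birkhoffSum dbl (realPsi c) n x ≤ birkhoffSum dbl (realPsi c) n z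
      + 2 * (2 * q * ((h + 3) * Real.log 2) + n * -Real.log (1 - 4 / 2 ^ q))
      + (h + 3) / q * -birkhoffSum dbl (realPsi c) n x := by
  have hterm : ∀ k ∈ Finset.range n, realPsi c (dbl^[k] x) ≤ realPsi c (dbl^[k] z)
      + 2 * (if n - k < 2 * q then ((h : ℝ) + 3) * Real.log 2 else 0)
      + 2 * -Real.log (1 - 4 / 2 ^ q) + ((h : ℝ) + 3) / q * -realPsi c (dbl^[k] x) := by
    intro k hk
    have hk := Finset.mem_range.1 hk
    have h1 : absCos (dbl^[k] x - c) ≤ absCos (dbl^[k] z - c) + 4 * (1 / 2 ^ (n - k)) := by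
      have h2 := absCos_le_add (dbl^[k] x - c) (dbl^[k] z - c)
      rw [sub_sub_sub_cancel_right] at h2
      have h3 : ‖dbl^[k] x - dbl^[k] z‖ ≤ 1 / 2 ^ (n - k) := by
        refine (norm_dbl_iterate_sub_le k x z).trans ?_
        calc (2 : ℝ) ^ k * ‖x - z‖ ≤ 2 ^ k * (1 / 2 ^ n) := by
              gcongr; exact norm_sub_le_of_mem_cyl hx hz
          _ = 1 / 2 ^ (n - k) := by
              rw [pow_sub₀ _ two_ne_zero hk.le]; field_simp
      have h4 := mul_le_mul Real.pi_le_four h3 (norm_nonneg _) (by norm_num)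
      linarith
    have := log_le_log_add hq (lt_of_le_of_ne (absCos_nonneg _) (hx0 k hk).symm)
      (absCos_le_one _) h1 (hz0 k hk)
    unfold realPsi
    linarith
  have hsum := Finset.sum_le_sum hterm
  simp only [Finset.sum_add_distrib, ← Finset.mul_sum, Finset.sum_neg_distrib] at hsum
  have hcard : ∑ k ∈ Finset.range n, (if n - k < 2 * q then ((h : ℝ) + 3) * Real.log 2 else 0)
      ≤ 2 * q * ((h + 3) * Real.log 2) := by
    rw [← Finset.sum_filter, Finset.sum_const, nsmul_eq_mul]
    have hsub : (Finset.range n).filter (fun k => n - k < 2 * q) ⊆ Finset.Ico (n - 2 * q) n := by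
      intro k hk
      simp only [Finset.mem_filter, Finset.mem_range, Finset.mem_Ico] at hk ⊢
      omega
    have hc := Finset.card_le_card hsub
    rw [Nat.card_Ico] at hc
    have hc' : (((Finset.range n).filter (fun k => n - k < 2 * q)).card : ℝ) ≤ 2 * q := by
      exact_mod_cast hc.trans (by omega)
    have : 0 ≤ ((h : ℝ) + 3) * Real.log 2 := by positivity
    gcongr
  simp only [Finset.sum_const, Finset.card_range, nsmul_eq_mul] at hsum
  unfold birkhoffSum
  linarith

/-! ### The pressure as a limit -/

lemma eexp_eq_exp (x : EReal) : eexp x = EReal.exp x := by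
  induction x with
  | bot => simp [eexp]
  | top => simp [eexp]
  | coe x => simp [eexp]

lemma elog_coe {x : ℝ≥0∞} (h0 : x ≠ 0) (h : x ≠ ⊤) : elog x = (Real.log x.toReal : ℝ) := by
  simp [elog, h0, h]

lemma elog_eq_log (x : ℝ≥0∞) : elog x = ENNReal.log x := rfl

/-- The summand of the partition function that belongs to the word `ω`. -/
def wordWeight (c : Torus) (t : ℝ) (n : ℕ) (ω : Fin n → Bool) : ℝ≥0∞ :=
  eexp ((t : EReal) * ⨆ x ∈ cyl n ω, psiSum c n x)

lemma presZ_eq (c : Torus) (t : ℝ) (n : ℕ) : presZ c t n = ∑ ω, wordWeight c t n ω := rfl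

lemma coe_mul_le_coe_mul {t : ℝ} (ht : 0 ≤ t) {a b : EReal} (h : a ≤ b) :
    (t : EReal) * a ≤ t * b :=
  mul_le_mul_of_nonneg_left h (EReal.coe_nonneg.2 ht)

lemma wordWeight_le_one {t : ℝ} (ht : 0 ≤ t) (c : Torus) (n : ℕ) (ω : Fin n → Bool) :
    wordWeight c t n ω ≤ 1 := by
  rw [wordWeight, eexp_eq_exp, EReal.exp_le_one_iff]
  calc _ ≤ (t : EReal) * 0 := coe_mul_le_coe_mul ht (iSup₂_le fun x _ => psiSum_nonpos c n x)
    _ = 0 := mul_zero _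

lemma presZ_le {t : ℝ} (ht : 0 ≤ t) (c : Torus) (n : ℕ) : presZ c t n ≤ 2 ^ n := by
  rw [presZ_eq]
  refine (Finset.sum_le_sum fun ω _ => wordWeight_le_one ht c n ω).trans ?_
  simp

lemma presZ_ne_top {t : ℝ} (ht : 0 ≤ t) (c : Torus) (n : ℕ) : presZ c t n ≠ ⊤ :=
  ne_top_of_le_ne_top (by simp) (presZ_le ht c n)

lemma psiSum_add (c : Torus) (n m : ℕ) (x : Torus) :
    psiSum c (n + m) x = psiSum c n x + psiSum c m (dbl^[n] x) := by
  unfold psiSum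
  simp_rw [Finset.sum_range_add, ← Function.iterate_add_apply, add_comm n]

lemma wordWeight_append_le {t : ℝ} (ht : 0 ≤ t) (c : Torus) {n m : ℕ} (a : Fin n → Bool)
    (b : Fin m → Bool) :
    wordWeight c t (n + m) (Fin.append a b) ≤ wordWeight c t n a * wordWeight c t m b := by
  simp only [wordWeight, eexp_eq_exp]
  rw [← EReal.exp_add, ← EReal.left_distrib_of_nonneg_of_ne_top (EReal.coe_nonneg.2 ht)
    (EReal.coe_ne_top t)]
  refine EReal.exp_monotone (coe_mul_le_coe_mul ht (iSup₂_le fun x hx => ?_))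
  obtain ⟨h1, h2⟩ := mem_cyl_of_mem_cyl_append hx
  rw [psiSum_add]
  exact add_le_add (le_iSup₂ (f := fun x (_ : x ∈ cyl n a) => psiSum c n x) x h1)
    (le_iSup₂ (f := fun x (_ : x ∈ cyl m b) => psiSum c m x) _ h2)

lemma presZ_add_le {t : ℝ} (ht : 0 ≤ t) (c : Torus) (n m : ℕ) :
    presZ c t (n + m) ≤ presZ c t n * presZ c t m := by
  simp only [presZ_eq]
  rw [← (Fin.appendEquiv n m).sum_comp, Fintype.sum_prod_type, Finset.sum_mul_sum]
  exact Finset.sum_le_sum fun a _ => Finset.sum_le_sum fun b _ => wordWeight_append_le ht c a b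

lemma absCos_ne_zero_of_far {c x : Torus} {ρ : ℝ} (hρ : 0 < ρ) (h : ρ ≤ ‖x - breve c‖) :
    absCos (x - c) ≠ 0 :=
  ne_of_gt (by linarith [two_mul_norm_le_absCos c x])

lemma le_realPsi_of_far {c x : Torus} {ρ : ℝ} (hρ : 0 < ρ) (h : ρ ≤ ‖x - breve c‖) :
    2 * Real.log (2 * ρ) ≤ realPsi c x := by
  unfold realPsi
  have := Real.log_le_log (by linarith : 0 < 2 * ρ)
    (by linarith [two_mul_norm_le_absCos c x] : 2 * ρ ≤ absCos (x - c))
  linarith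

lemma le_birkhoffSum_of_far {c x : Torus} {ρ : ℝ} (hρ : 0 < ρ) {n : ℕ}
    (h : ∀ k < n, ρ ≤ ‖dbl^[k] x - breve c‖) :
    n * (2 * Real.log (2 * ρ)) ≤ birkhoffSum dbl (realPsi c) n x := by
  have := Finset.card_nsmul_le_sum (Finset.range n) (fun k => realPsi c (dbl^[k] x)) _
    fun k hk => le_realPsi_of_far hρ (h k (Finset.mem_range.1 hk))
  simpa [birkhoffSum] using this

lemma ofReal_exp_birkhoffSum_le {t : ℝ} (ht : 0 ≤ t) {c : Torus} {n : ℕ} {x : Torus}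
    (h : ∀ k < n, absCos (dbl^[k] x - c) ≠ 0) {s : EReal} (hs : psiSum c n x ≤ s) :
    ENNReal.ofReal (Real.exp (t * birkhoffSum dbl (realPsi c) n x)) ≤ eexp ((t : EReal) * s) := by
  rw [eexp_eq_exp, ← EReal.exp_coe, EReal.coe_mul, ← psiSum_eq_birkhoffSum h]
  exact EReal.exp_monotone (coe_mul_le_coe_mul ht hs)

lemma exists_exp_le_presZ {t : ℝ} (ht : 0 ≤ t) (c : Torus) :
    ∃ C : ℝ, ∀ n : ℕ, ENNReal.ofReal (Real.exp (n * C)) ≤ presZ c t n := by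
  obtain ⟨y, ρ, hρ, hy⟩ := exists_orbit_far c
  refine ⟨t * (2 * Real.log (2 * ρ)), fun n => ?_⟩
  rw [presZ_eq]
  refine le_trans ?_ (Finset.single_le_sum (f := wordWeight c t n) (fun _ _ => zero_le)
    (Finset.mem_univ fun i : Fin n => y i))
  refine le_trans ?_ (ofReal_exp_birkhoffSum_le ht (x := toTorus y)
    (fun k _ => absCos_ne_zero_of_far hρ (hy k))
    (le_iSup₂ (f := fun x (_ : x ∈ cyl n fun i => y i) => psiSum c n x) (toTorus y)
      (toTorus_mem_cyl fun _ => rfl)))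
  refine ENNReal.ofReal_le_ofReal (Real.exp_le_exp.2 ?_)
  have := mul_le_mul_of_nonneg_left (le_birkhoffSum_of_far hρ (n := n) fun k _ => hy k) ht
  linarith

lemma presZ_ne_zero {t : ℝ} (ht : 0 ≤ t) (c : Torus) (n : ℕ) : presZ c t n ≠ 0 := by
  obtain ⟨C, hC⟩ := exists_exp_le_presZ ht c
  exact ne_of_gt (lt_of_lt_of_le (ENNReal.ofReal_pos.2 (Real.exp_pos _)) (hC n))

lemma exists_tendsto_presZ {t : ℝ} (ht : 0 ≤ t) (c : Torus) :
    ∃ P : ℝ, (∀ n : ℕ, n ≠ 0 → Real.exp (n * P) ≤ (presZ c t n).toReal) ∧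
      Tendsto (fun n : ℕ => (((n : ℝ)⁻¹ : ℝ) : EReal) * elog (presZ c t n)) atTop (𝓝 (P : EReal)) := by
  set u : ℕ → ℝ := fun n => Real.log (presZ c t n).toReal with hu
  have hpos : ∀ n, 0 < (presZ c t n).toReal := fun n =>
    ENNReal.toReal_pos (presZ_ne_zero ht c n) (presZ_ne_top ht c n)
  have hsub : Subadditive u := by
    intro n m
    simp only [hu]
    rw [← Real.log_mul (hpos n).ne' (hpos m).ne', ← ENNReal.toReal_mul]
    refine Real.log_le_log (hpos _) (ENNReal.toReal_mono ?_ (presZ_add_le ht c n m))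
    exact ENNReal.mul_ne_top (presZ_ne_top ht c n) (presZ_ne_top ht c m)
  have hbdd : BddBelow (range fun n => u n / n) := by
    obtain ⟨C, hC⟩ := exists_exp_le_presZ ht c
    refine ⟨min C 0, ?_⟩
    rintro _ ⟨n, rfl⟩
    rcases Nat.eq_zero_or_pos n with rfl | hn
    · simp
    · have hn' : (0 : ℝ) < n := by exact_mod_cast hn
      refine (min_le_left _ _).trans ?_
      simp only [hu]
      rw [le_div_iff₀ hn', Real.le_log_iff_exp_le (hpos n), mul_comm]
      exact (ENNReal.ofReal_le_iff_le_toReal (presZ_ne_top ht c n)).1 (hC n)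
  refine ⟨hsub.lim, fun n hn => ?_, ?_⟩
  · rw [← Real.le_log_iff_exp_le (hpos n), mul_comm,
      ← le_div_iff₀ (by exact_mod_cast Nat.pos_of_ne_zero hn)]
    exact hsub.lim_le_div hbdd hn
  · have := (continuous_coe_real_ereal.tendsto _).comp (hsub.tendsto_lim hbdd)
    refine this.congr fun n => ?_
    rw [elog_coe (presZ_ne_zero ht c n) (presZ_ne_top ht c n), ← EReal.coe_mul]
    simp only [Function.comp_apply, hu]
    rw [div_eq_inv_mul]

lemma presZRes_le_presZ {t : ℝ} (ht : 0 ≤ t) (c : Torus) (m n : ℕ) :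
    presZRes c m t n ≤ presZ c t n := by
  refine Finset.sum_le_sum fun ω _ => ?_
  split_ifs
  · rw [eexp_eq_exp, eexp_eq_exp]
    refine EReal.exp_monotone (coe_mul_le_coe_mul ht (iSup₂_le fun x hx => ?_))
    exact le_iSup₂ (f := fun x (_ : x ∈ cyl n ω) => psiSum c n x) _ (toTorus_mem_cyl hx.2)
  · exact zero_le

lemma presResUpper_le_presUpper {t : ℝ} (ht : 0 ≤ t) (c : Torus) (m : ℕ) :
    presResUpper c m t ≤ presUpper c t := by
  refine limsup_le_limsup (Eventually.of_forall fun n => ?_)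
  refine coe_mul_le_coe_mul (by positivity) ?_
  rw [elog_eq_log, elog_eq_log]
  exact ENNReal.log_monotone (presZRes_le_presZ ht c m n)

/-! ### Lower bounds for the restricted pressure -/

/-- The loss in the exponent when a word of length `n` is glued to an arbitrary sequence by a
spacer of length `2 * p`. -/
def gluingLoss (c : Torus) (t C : ℝ) (n p q : ℕ) : ℝ :=
  C * n * ((2 * p + 3) / q)
    + t * (2 * (2 * q * ((2 * p + 3) * Real.log 2) + n * -Real.log (1 - 4 / 2 ^ q)))
    - t * (2 * p * (2 * Real.log (2 * (‖c‖ / 3))))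

lemma iSup_psiSum_le {c : Torus} {n h q : ℕ} {ω : Fin n → Bool} {z : Torus} (hq : 3 ≤ q)
    (hz : z ∈ cyl n ω)
    (hz0 : ∀ k < n, 1 / 2 ^ (n - k) ≤ absCos (dbl^[k] z - c) * 2 ^ h) :
    ⨆ x ∈ cyl n ω, psiSum c n x ≤ (((birkhoffSum dbl (realPsi c) n z
      + 2 * (2 * q * ((h + 3) * Real.log 2) + n * -Real.log (1 - 4 / 2 ^ q)))
        / (1 + (h + 3) / q) : ℝ) : EReal) := by
  refine iSup₂_le fun x hx => ?_
  by_cases hx0 : ∀ k < n, absCos (dbl^[k] x - c) ≠ 0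
  · rw [psiSum_eq_birkhoffSum hx0, EReal.coe_le_coe_iff, le_div_iff₀ (by positivity)]
    linarith [birkhoffSum_le_of_mem_cyl hq hx hz hx0 hz0]
  · push Not at hx0
    obtain ⟨k, hk, h0⟩ := hx0
    rw [psiSum_eq_bot hk h0]
    exact bot_le

lemma le_birkhoffSum_of_weight {c : Torus} {t C : ℝ} (ht : 0 ≤ t) {n h q : ℕ}
    {ω : Fin n → Bool} {z : Torus} (hq : 3 ≤ q) (hz : z ∈ cyl n ω)
    (hz0 : ∀ k < n, 1 / 2 ^ (n - k) ≤ absCos (dbl^[k] z - c) * 2 ^ h)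
    (hω : Real.exp (-(C * n)) ≤ (wordWeight c t n ω).toReal) :
    Real.log (wordWeight c t n ω).toReal ≤ t * birkhoffSum dbl (realPsi c) n z
      + t * (2 * (2 * q * ((h + 3) * Real.log 2) + n * -Real.log (1 - 4 / 2 ^ q)))
      + C * n * ((h + 3) / q) := by
  have hpos : 0 < (wordWeight c t n ω).toReal := (Real.exp_pos _).trans_le hω
  set α : ℝ := 2 * (2 * q * ((h + 3) * Real.log 2) + n * -Real.log (1 - 4 / 2 ^ q)) with hα
  set β : ℝ := (h + 3) / q with hβ
  have hβ0 : 0 ≤ β := by positivity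
  have h1 : wordWeight c t n ω ≤
      ENNReal.ofReal (Real.exp (t * ((birkhoffSum dbl (realPsi c) n z + α) / (1 + β)))) := by
    rw [wordWeight, eexp_eq_exp, ← EReal.exp_coe, EReal.coe_mul]
    exact EReal.exp_monotone (coe_mul_le_coe_mul ht (iSup_psiSum_le hq hz hz0))
  have h2 : Real.log (wordWeight c t n ω).toReal
      ≤ t * ((birkhoffSum dbl (realPsi c) n z + α) / (1 + β)) := by
    rw [Real.log_le_iff_le_exp hpos]
    exact ENNReal.toReal_le_of_le_ofReal (Real.exp_pos _).le h1
  have h3 := (Real.le_log_iff_exp_le hpos).2 hω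
  rw [← mul_div_assoc, le_div_iff₀ (by positivity)] at h2
  have h4 := mul_le_mul_of_nonneg_right h3 hβ0
  linarith

/-- The glued sequence: a word `ω` of large weight, followed by a spacer, followed by `y`. -/
lemma exists_glue {c : Torus} (hc : c ≠ 0) {t C : ℝ} (ht : 0 ≤ t) {n p q : ℕ} (hq : 3 ≤ q)
    (hn : n < 2 ^ p) (ω : Fin n → Bool)
    (hω : Real.exp (-(C * n)) ≤ (wordWeight c t n ω).toReal) (y : ℕ → Bool) :
    ∃ z : ℕ → Bool, (∀ i : Fin n, z i = ω i) ∧ shift (n + 2 * p) z = y ∧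
      (∀ k < n + 2 * p,
        min (‖c‖ / 3) (1 / 2 ^ (n + 2 * p + 1)) ≤ ‖dbl^[k] (toTorus z) - breve c‖) ∧
      (wordWeight c t n ω).toReal * Real.exp (-gluingLoss c t C n p q)
        ≤ Real.exp (t * birkhoffSum dbl (realPsi c) (n + 2 * p) (toTorus z)) := by
  obtain ⟨w, hw, hfar, hsep⟩ := exists_spacer c p n hn y
  have hc0 : 0 < ‖c‖ / 3 := by have := norm_pos_iff.2 hc; positivity
  set z := wordAppend n ω w with hz
  have hzw : dbl^[n] (toTorus z) = toTorus w := by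
    rw [dbl_iterate_toTorus, hz, shift_wordAppend]
  have hsep' : ∀ k < n, 1 / 2 ^ (2 * p + 1) ≤ 2 ^ (n - k) * ‖dbl^[k] (toTorus z) - breve c‖ := by
    intro k hk
    have h1 := hsep (n - k) (Finset.mem_Icc.2 ⟨by omega, by omega⟩)
    rw [← hzw] at h1
    have h2 := norm_dbl_iterate_sub_le (n - k) (dbl^[k] (toTorus z)) (breve c)
    rw [← Function.iterate_add_apply, Nat.sub_add_cancel hk.le] at h2
    exact h1.trans h2
  have hcyl : toTorus z ∈ cyl n ω := toTorus_mem_cyl (wordAppend_apply n ω w)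
  refine ⟨z, wordAppend_apply n ω w, ?_, fun k hk => ?_, ?_⟩
  · rw [add_comm, ← shift_shift, hz, shift_wordAppend, hw]
  · rcases lt_or_ge k n with hlt | hge
    · refine (min_le_right _ _).trans ?_
      have h1 := hsep' k hlt
      have h2 : (2 : ℝ) ^ (n - k) ≤ 2 ^ n := pow_le_pow_right₀ one_le_two (Nat.sub_le _ _)
      have h3 := mul_le_mul_of_nonneg_right h2 (norm_nonneg (dbl^[k] (toTorus z) - breve c))
      rw [show n + 2 * p + 1 = n + (2 * p + 1) by ring, pow_add, ← div_div, div_right_comm,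
        div_le_iff₀ (by positivity)]
      linarith
    · refine (min_le_left _ _).trans ?_
      obtain ⟨i, rfl⟩ := Nat.exists_eq_add_of_le hge
      rw [add_comm, Function.iterate_add_apply, hzw]
      exact hfar i (by omega)
  · have hpos : 0 < (wordWeight c t n ω).toReal := (Real.exp_pos _).trans_le hω
    rw [← Real.exp_log hpos, ← Real.exp_add, Real.exp_le_exp, birkhoffSum_add, hzw]
    have h1 := le_birkhoffSum_of_weight (h := 2 * p) ht hq hcyl (fun k hk => ?_) hω
    · have h2 := mul_le_mul_of_nonneg_left (le_birkhoffSum_of_far hc0 hfar) ht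
      unfold gluingLoss
      push_cast at h1 h2
      linarith
    · have h3 := hsep' k hk
      have h4 := two_mul_norm_le_absCos c (dbl^[k] (toTorus z))
      have h5 : (0 : ℝ) < 2 ^ (n - k) := by positivity
      have h6 : (0 : ℝ) < 2 ^ (2 * p) := by positivity
      rw [div_le_iff₀ (by positivity), pow_succ] at h3
      rw [div_le_iff₀ h5]
      calc (1 : ℝ) ≤ 2 ^ (n - k) * ‖dbl^[k] (toTorus z) - breve c‖ * (2 ^ (2 * p) * 2) := h3
        _ = (2 * ‖dbl^[k] (toTorus z) - breve c‖) * (2 ^ (2 * p) * 2 ^ (n - k)) := by ring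
        _ ≤ absCos (dbl^[k] (toTorus z) - c) * (2 ^ (2 * p) * 2 ^ (n - k)) := by gcongr
        _ = _ := by ring

/-- Gluing `K` words gives a family of orbits, uniformly far from the singularity and determined
by their first `K * (n + 2 * p)` digits, of exponentially large total weight. -/
lemma exists_family {c : Torus} (hc : c ≠ 0) {t C : ℝ} (ht : 0 ≤ t) {n p q : ℕ} (hq : 3 ≤ q)
    (hn : n < 2 ^ p) (G : Finset (Fin n → Bool))
    (hG : ∀ ω ∈ G, Real.exp (-(C * n)) ≤ (wordWeight c t n ω).toReal) :
    ∃ ρ : ℝ, 0 < ρ ∧ ∀ K : ℕ, ∃ F : Finset (ℕ → Bool),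
      (∀ y ∈ F, ∀ k, ρ ≤ ‖dbl^[k] (toTorus y) - breve c‖) ∧
      (∀ y ∈ F, ∀ y' ∈ F, (∀ i < K * (n + 2 * p), y i = y' i) → y = y') ∧
      ((∑ ω ∈ G, (wordWeight c t n ω).toReal) * Real.exp (-gluingLoss c t C n p q)) ^ K
        ≤ ∑ y ∈ F, Real.exp (t * birkhoffSum dbl (realPsi c) (K * (n + 2 * p)) (toTorus y)) := by
  classical
  obtain ⟨y₀, ρ₀, hρ₀, hy₀⟩ := exists_orbit_far c
  have hc0 : 0 < ‖c‖ / 3 := by have := norm_pos_iff.2 hc; positivity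
  set N := n + 2 * p with hN
  refine ⟨min ρ₀ (min (‖c‖ / 3) (1 / 2 ^ (N + 1))), lt_min hρ₀ (lt_min hc0 (by positivity)),
    fun K => ?_⟩
  have hglue : ∀ ω y, ∃ z : ℕ → Bool, ω ∈ G → (∀ i : Fin n, z i = ω i) ∧ shift N z = y ∧
      (∀ k < N, min (‖c‖ / 3) (1 / 2 ^ (N + 1)) ≤ ‖dbl^[k] (toTorus z) - breve c‖) ∧
      (wordWeight c t n ω).toReal * Real.exp (-gluingLoss c t C n p q)
        ≤ Real.exp (t * birkhoffSum dbl (realPsi c) N (toTorus z)) := by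
    intro ω y
    by_cases hω : ω ∈ G
    · obtain ⟨z, hz⟩ := exists_glue hc ht hq hn ω (hG ω hω) y
      exact ⟨z, fun _ => hz⟩
    · exact ⟨y, fun h => absurd h hω⟩
  choose g hg using hglue
  induction K with
  | zero =>
    refine ⟨{y₀}, fun y hy k => ?_, ?_, by simp [birkhoffSum]⟩
    · rw [Finset.mem_singleton.1 hy]
      exact (min_le_left _ _).trans (hy₀ k)
    · intro y hy y' hy' _
      rw [Finset.mem_singleton.1 hy, Finset.mem_singleton.1 hy']
  | succ K ih =>
    obtain ⟨F, hF1, hF2, hF3⟩ := ih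
    have hdet : ∀ a ∈ G ×ˢ F, ∀ b ∈ G ×ˢ F,
        (∀ i < (K + 1) * N, g a.1 a.2 i = g b.1 b.2 i) → a = b := by
      rintro ⟨ω, y⟩ ha ⟨ω', y'⟩ hb h
      obtain ⟨hω, hy⟩ := Finset.mem_product.1 ha
      obtain ⟨hω', hy'⟩ := Finset.mem_product.1 hb
      obtain ⟨d, s, -, -⟩ := hg ω y hω
      obtain ⟨d', s', -, -⟩ := hg ω' y' hω'
      have hN1 : (K + 1) * N = K * N + N := by ring
      have e1 : ω = ω' := by
        funext i
        rw [← d i, ← d' i]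
        exact h i (by have := i.2; omega)
      have e2 : y = y' := by
        refine hF2 y hy y' hy' fun i hi => ?_
        rw [← s, ← s']
        exact h (i + N) (by omega)
      rw [e1, e2]
    refine ⟨(G ×ˢ F).image fun a => g a.1 a.2, ?_, ?_, ?_⟩
    · intro z hz k
      obtain ⟨⟨ω, y⟩, ha, rfl⟩ := Finset.mem_image.1 hz
      obtain ⟨hω, hy⟩ := Finset.mem_product.1 ha
      obtain ⟨-, s, far, -⟩ := hg ω y hω
      rcases lt_or_ge k N with hlt | hge
      · exact (min_le_right _ _).trans (far k hlt)
      · obtain ⟨i, rfl⟩ := Nat.exists_eq_add_of_le hge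
        rw [add_comm N i, Function.iterate_add_apply, dbl_iterate_toTorus N, s]
        exact hF1 y hy i
    · intro z hz z' hz' h
      obtain ⟨a, ha, rfl⟩ := Finset.mem_image.1 hz
      obtain ⟨b, hb, rfl⟩ := Finset.mem_image.1 hz'
      rw [hdet a ha b hb h]
    · rw [Finset.sum_image fun a ha b hb h => hdet a ha b hb fun i _ => congrFun h i,
        pow_succ', Finset.sum_product]
      generalize ((∑ ω ∈ G, (wordWeight c t n ω).toReal) *
        Real.exp (-gluingLoss c t C n p q)) ^ K = B at hF3 ⊢
      rw [Finset.sum_mul, Finset.sum_mul]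
      refine Finset.sum_le_sum fun ω hω => ?_
      refine (mul_le_mul_of_nonneg_left hF3 (by positivity)).trans ?_
      rw [Finset.mul_sum]
      refine Finset.sum_le_sum fun y _ => ?_
      obtain ⟨-, s, -, hle⟩ := hg ω y hω
      rw [show (K + 1) * N = N + K * N by ring, birkhoffSum_add, dbl_iterate_toTorus, s, mul_add t,
        Real.exp_add]
      exact mul_le_mul_of_nonneg_right hle (Real.exp_pos _).le

lemma mem_Xcm_of_far {c : Torus} {m : ℕ} {x : ℕ → Bool} {ρ : ℝ} (hm : 1 / 2 ^ (m + 1) < ρ)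
    (h : ∀ k, ρ ≤ ‖dbl^[k] (toTorus x) - breve c‖) : x ∈ Xcm c m := by
  intro ℓ b hb
  by_contra! H
  have h1 := norm_sub_le_of_mem_cyl (n := m + 1) (ω := fun i => b i) (x := toTorus (shift ℓ x))
    (z := toTorus b) (toTorus_mem_cyl fun i => by rw [shift, add_comm, H i])
    (toTorus_mem_cyl fun _ => rfl)
  rw [← dbl_iterate_toTorus, show toTorus b = breve c from hb] at h1
  linarith [h ℓ]

lemma sum_exp_le_presZRes {c : Torus} {t : ℝ} (ht : 0 ≤ t) {m n : ℕ} {ρ : ℝ} (hρ : 0 < ρ)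
    (hm : 1 / 2 ^ (m + 1) < ρ) (F : Finset (ℕ → Bool))
    (hF : ∀ y ∈ F, ∀ k, ρ ≤ ‖dbl^[k] (toTorus y) - breve c‖)
    (hinj : ∀ y ∈ F, ∀ y' ∈ F, (∀ i < n, y i = y' i) → y = y') :
    ENNReal.ofReal (∑ y ∈ F, Real.exp (t * birkhoffSum dbl (realPsi c) n (toTorus y)))
      ≤ presZRes c m t n := by
  classical
  rw [ENNReal.ofReal_sum_of_nonneg fun _ _ => (Real.exp_pos _).le, presZRes]
  have hinj' : Set.InjOn (fun (y : ℕ → Bool) (i : Fin n) => y i) F := fun y hy y' hy' h =>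
    hinj y hy y' hy' fun i hi => congrFun h ⟨i, hi⟩
  refine le_trans ?_ (Finset.sum_le_sum_of_subset
    (Finset.subset_univ (F.image fun y (i : Fin n) => y i)))
  rw [Finset.sum_image hinj']
  refine Finset.sum_le_sum fun y hy => ?_
  have hX := mem_Xcm_of_far hm (hF y hy)
  rw [if_pos ⟨y, hX, fun _ => rfl⟩]
  refine ofReal_exp_birkhoffSum_le ht (fun k _ => absCos_ne_zero_of_far hρ (hF y hy k)) ?_
  exact le_iSup₂ (f := fun x (_ : x ∈ {x ∈ Xcm c m | ∀ i : Fin n, x i = y i}) =>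
    psiSum c n (toTorus x)) y ⟨hX, fun _ => rfl⟩

lemma eventually_le_presResUpper {c : Torus} (hc : c ≠ 0) {t C : ℝ} (ht : 0 ≤ t) {n p q : ℕ}
    (hq : 3 ≤ q) (hn : n < 2 ^ p) (hn0 : n ≠ 0) (G : Finset (Fin n → Bool))
    (hG : ∀ ω ∈ G, Real.exp (-(C * n)) ≤ (wordWeight c t n ω).toReal)
    (hsum : 0 < ∑ ω ∈ G, (wordWeight c t n ω).toReal) :
    ∀ᶠ m in atTop, (((Real.log (∑ ω ∈ G, (wordWeight c t n ω).toReal) - gluingLoss c t C n p q)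
      / (n + 2 * p) : ℝ) : EReal) ≤ presResUpper c m t := by
  obtain ⟨ρ, hρ, hfam⟩ := exists_family hc ht hq hn G hG
  have hlim : Tendsto (fun m : ℕ => (1 : ℝ) / 2 ^ (m + 1)) atTop (𝓝 0) :=
    hasSum_half_pow.summable.tendsto_atTop_zero
  filter_upwards [hlim.eventually (gt_mem_nhds hρ)] with m hm
  refine le_limsup_of_frequently_le' (frequently_atTop.2 fun a => ?_)
  refine ⟨(a + 1) * (n + 2 * p), by nlinarith [Nat.pos_of_ne_zero hn0], ?_⟩
  obtain ⟨F, hF1, hF2, hF3⟩ := hfam (a + 1)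
  set A : ℝ := ∑ ω ∈ G, (wordWeight c t n ω).toReal with hA
  have h1 := (ENNReal.ofReal_le_ofReal hF3).trans (sum_exp_le_presZRes ht hρ hm F hF1 hF2)
  have h2 := ENNReal.log_monotone h1
  have hApos : 0 < A * Real.exp (-gluingLoss c t C n p q) := mul_pos hsum (Real.exp_pos _)
  rw [ENNReal.log_ofReal_of_pos (pow_pos hApos _), Real.log_pow,
    Real.log_mul hsum.ne' (Real.exp_pos _).ne', Real.log_exp] at h2
  rw [elog_eq_log]
  refine le_trans (le_of_eq ?_) (coe_mul_le_coe_mul (by positivity) h2)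
  rw [← EReal.coe_mul]
  congr 1
  have hn' : (0 : ℝ) < n := by exact_mod_cast Nat.pos_of_ne_zero hn0
  push_cast
  field_simp
  ring

/-! ### Conclusion -/

/-- Discarding the words of exponentially small weight does not change the growth rate. -/
lemma exists_finset_le_log_sum {c : Torus} {t P : ℝ} (ht : 0 ≤ t) {n : ℕ} (hn : n ≠ 0)
    (hP : Real.exp (n * P) ≤ (presZ c t n).toReal) :
    ∃ G : Finset (Fin n → Bool),
      (∀ ω ∈ G, Real.exp (-((2 * Real.log 2 + |P|) * n)) ≤ (wordWeight c t n ω).toReal) ∧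
      0 < ∑ ω ∈ G, (wordWeight c t n ω).toReal ∧
      n * P - Real.log 2 ≤ Real.log (∑ ω ∈ G, (wordWeight c t n ω).toReal) := by
  classical
  set a : (Fin n → Bool) → ℝ := fun ω => (wordWeight c t n ω).toReal
  set e : ℝ := Real.exp (-((2 * Real.log 2 + |P|) * n)) with he
  set G := Finset.univ.filter fun ω => e ≤ a ω with hG
  have hsplit : (presZ c t n).toReal = ∑ ω ∈ G, a ω + ∑ ω with ¬ e ≤ a ω, a ω := by
    rw [presZ_eq, ENNReal.toReal_sum fun ω _ =>
      ((wordWeight_le_one ht c n ω).trans_lt ENNReal.one_lt_top).ne]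
    exact (Finset.sum_filter_add_sum_filter_not _ _ _).symm
  have hsmall : ∑ ω with ¬ e ≤ a ω, a ω ≤ 2 ^ n * e := by
    refine (Finset.sum_le_card_nsmul _ _ e fun ω hω =>
      (not_le.1 (Finset.mem_filter.1 hω).2).le).trans ?_
    rw [nsmul_eq_mul]
    refine mul_le_mul_of_nonneg_right ?_ (Real.exp_pos _).le
    have := Finset.card_filter_le (Finset.univ : Finset (Fin n → Bool)) fun ω => ¬ e ≤ a ω
    rw [Finset.card_univ, Fintype.card_fun, Fintype.card_bool, Fintype.card_fin] at this
    exact_mod_cast this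
  have hn1 : (1 : ℝ) ≤ n := by exact_mod_cast Nat.one_le_iff_ne_zero.2 hn
  have hlog : 0 < Real.log 2 := Real.log_pos one_lt_two
  have hbound : 2 ^ n * e ≤ Real.exp (n * P - Real.log 2) := by
    rw [← Real.exp_log (show (0 : ℝ) < 2 ^ n by positivity), Real.log_pow, he, ← Real.exp_add,
      Real.exp_le_exp]
    nlinarith [neg_abs_le P]
  have hhalf : Real.exp (n * P) = 2 * Real.exp (n * P - Real.log 2) := by
    rw [Real.exp_sub, Real.exp_log two_pos]
    ring
  have hmain : Real.exp (n * P - Real.log 2) ≤ ∑ ω ∈ G, a ω := by linarith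
  have hpos := (Real.exp_pos _).trans_le hmain
  exact ⟨G, fun ω hω => (Finset.mem_filter.1 hω).2, hpos, (Real.le_log_iff_exp_le hpos).2 hmain⟩

lemma tendsto_lower_bound (c : Torus) (t C P : ℝ) :
    Tendsto (fun k : ℕ => (((2 ^ k : ℕ) : ℝ) * P - Real.log 2
      - gluingLoss c t C (2 ^ k) (k + 1) (k ^ 2)) / (((2 ^ k : ℕ) : ℝ) + 2 * (k + 1 : ℕ)))
      atTop (𝓝 P) := by
  have hpow (j : ℕ) : Tendsto (fun k : ℕ => (k : ℝ) ^ j / 2 ^ k) atTop (𝓝 0) :=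
    tendsto_pow_const_div_const_pow_of_one_lt j one_lt_two
  have hinv : Tendsto (fun k : ℕ => (k : ℝ)⁻¹) atTop (𝓝 0) := tendsto_inv_atTop_nhds_zero_nat
  have hq : Tendsto (fun k : ℕ => Real.log (1 - 4 / 2 ^ (k ^ 2))) atTop (𝓝 0) := by
    have h1 : Tendsto (fun k : ℕ => (4 : ℝ) / 2 ^ (k ^ 2)) atTop (𝓝 0) :=
      ((tendsto_pow_atTop_atTop_of_one_lt one_lt_two).comp
        (tendsto_pow_atTop two_ne_zero)).const_div_atTop 4
    have h2 : Tendsto (fun k : ℕ => (1 : ℝ) - 4 / 2 ^ (k ^ 2)) atTop (𝓝 1) := by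
      simpa using h1.const_sub 1
    simpa using h2.log one_ne_zero
  have hnum : Tendsto (fun k : ℕ => P - Real.log 2 * ((k : ℝ) ^ 0 / 2 ^ k)
      - (C * (2 * (k : ℝ)⁻¹ + 5 * ((k : ℝ)⁻¹ * (k : ℝ)⁻¹))
        + t * (2 * (2 * ((2 * ((k : ℝ) ^ 3 / 2 ^ k) + 5 * ((k : ℝ) ^ 2 / 2 ^ k)) * Real.log 2)
          + -Real.log (1 - 4 / 2 ^ (k ^ 2))))
        - t * (2 * ((k : ℝ) ^ 1 / 2 ^ k + (k : ℝ) ^ 0 / 2 ^ k)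
          * (2 * Real.log (2 * (‖c‖ / 3)))))) atTop
      (𝓝 (P - Real.log 2 * 0 - (C * (2 * 0 + 5 * (0 * 0))
        + t * (2 * (2 * ((2 * 0 + 5 * 0) * Real.log 2) + -0))
        - t * (2 * (0 + 0) * (2 * Real.log (2 * (‖c‖ / 3))))))) := by
    refine ((hpow 0).const_mul _).const_sub _ |>.sub (.sub (.add ?_ ?_) ?_)
    · exact ((hinv.const_mul 2).add ((hinv.mul hinv).const_mul 5)).const_mul C
    · exact ((((((hpow 3).const_mul 2).add ((hpow 2).const_mul 5)).mul_const _).const_mul 2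
        |>.add hq.neg).const_mul 2).const_mul t
    · exact ((((hpow 1).add (hpow 0)).const_mul 2).mul_const _).const_mul t
  have hden : Tendsto (fun k : ℕ => 1 + 2 * ((k : ℝ) ^ 1 / 2 ^ k + (k : ℝ) ^ 0 / 2 ^ k)) atTop
      (𝓝 (1 + 2 * (0 + 0))) := (((hpow 1).add (hpow 0)).const_mul 2).const_add 1
  have hquot := hnum.div hden (by norm_num)
  simp only [add_zero, mul_zero, neg_zero, zero_mul, sub_zero, div_one] at hquot
  refine hquot.congr' ?_
  filter_upwards [eventually_ge_atTop 1] with k hk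
  have hk0 : (k : ℝ) ≠ 0 := by positivity
  have h2 : (2 : ℝ) ^ k ≠ 0 := by positivity
  have hd : (2 : ℝ) ^ k + 2 * (k + 1) ≠ 0 := by positivity
  have hd' : 1 + 2 * ((k : ℝ) ^ 1 / 2 ^ k + (k : ℝ) ^ 0 / 2 ^ k) ≠ 0 := by positivity
  simp only [Pi.div_apply]
  rw [gluingLoss]
  push_cast
  rw [div_eq_div_iff hd' hd]
  generalize Real.log (1 - 4 / 2 ^ (k ^ 2)) = l
  generalize (2 : ℝ) ^ k = x at *
  field_simp
  ring

lemma eventually_lt_presResUpper {c : Torus} (hc : c ≠ 0) {t P a : ℝ} (ht : 0 ≤ t)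
    (hP : ∀ n : ℕ, n ≠ 0 → Real.exp (n * P) ≤ (presZ c t n).toReal) (ha : a < P) :
    ∀ᶠ m in atTop, (a : EReal) < presResUpper c m t := by
  obtain ⟨k, hk, hk2⟩ := (((tendsto_lower_bound c t (2 * Real.log 2 + |P|) P).eventually
    (lt_mem_nhds ha)).and (eventually_ge_atTop 2)).exists
  have hn0 : 2 ^ k ≠ 0 := by positivity
  obtain ⟨G, hG, hpos, hlog⟩ := exists_finset_le_log_sum ht hn0 (hP _ hn0)
  filter_upwards [eventually_le_presResUpper hc ht (p := k + 1) (q := k ^ 2) (by nlinarith)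
    (Nat.pow_lt_pow_succ one_lt_two) hn0 G hG hpos] with m hm
  refine lt_of_lt_of_le (EReal.coe_lt_coe_iff.2 (hk.trans_le ?_)) hm
  gcongr

/-- for `c ≠ 0` and `t ≥ 0`, the topological pressure exists as a limit and
is finite, and the restricted pressures `P̄_top(t ψ^c | X^c_m)` converge to it as `m → ∞`. -/
theorem stmt3 (c : Torus) (hc : c ≠ 0) (t : ℝ) (ht : 0 ≤ t) :
    presUpper c t = presLower c t ∧
      (∃ r : ℝ, presUpper c t = (r : EReal)) ∧
      Tendsto (fun m : ℕ => presResUpper c m t) atTop (𝓝 (presUpper c t)) := by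
  obtain ⟨P, hP, hlim⟩ := exists_tendsto_presZ ht c
  have hU : presUpper c t = P := hlim.limsup_eq
  have hL : presLower c t = P := hlim.liminf_eq
  refine ⟨hU.trans hL.symm, ⟨P, hU⟩, tendsto_order.2 ⟨fun a ha => ?_, fun a ha => ?_⟩⟩
  · obtain ⟨b, hab, hb⟩ := EReal.lt_iff_exists_real_btwn.1 ha
    rw [hU, EReal.coe_lt_coe_iff] at hb
    exact (eventually_lt_presResUpper hc ht hP hb).mono fun m hm => hab.trans hm
  · exact Eventually.of_forall fun m => (presResUpper_le_presUpper ht c m).trans_lt ha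

end GTM
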